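/- Let G₉ be the subgroup of G₁₁ generated by s and u, let Z₉ = {1, z³, z⁶, …, z²¹}, U = {1, u, u², u³}, and X₉ = {1, s, s·u, s·u·s, s·u², s·u²·s}. Then the map Z₉ × U × X₉ → G₉ sending (y, v, x) to y·v·x is a bijection onto G₉. -/

import Mathlib

open Pointwise

namespace Octa

def rels : Set (FreeGroup (Fin 3)) :=
  { FreeGroup.of 0 ^ 2, FreeGroup.of 1 ^ 3, FreeGroup.of 2 ^ 4,
    FreeGroup.of 0 * FreeGroup.of 1 * FreeGroup.of 2 *
      (FreeGroup.of 1 * FreeGroup.of 2 * FreeGroup.of 0)⁻¹,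
    FreeGroup.of 0 * FreeGroup.of 1 * FreeGroup.of 2 *
      (FreeGroup.of 2 * FreeGroup.of 0 * FreeGroup.of 1)⁻¹ }

/-- The group `G₁₁ = ⟨s, t, u | s² = t³ = u⁴ = 1, stu = tus = ust⟩`. -/
abbrev G11 := PresentedGroup rels

def s : G11 := PresentedGroup.of 0
def t : G11 := PresentedGroup.of 1
def u : G11 := PresentedGroup.of 2
def z : G11 := s * t * u

def G9 : Subgroup G11 := Subgroup.closure {s, u}

theorem hs : s ^ 2 = 1 := by
  have := PresentedGroup.one_of_mem (rels := rels) (x := FreeGroup.of 0 ^ 2) (by simp [rels])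
  rw [map_pow] at this
  exact this
theorem ht : t ^ 3 = 1 := by
  have := PresentedGroup.one_of_mem (rels := rels) (x := FreeGroup.of 1 ^ 3) (by simp [rels])
  rw [map_pow] at this
  exact this
theorem hu : u ^ 4 = 1 := by
  have := PresentedGroup.one_of_mem (rels := rels) (x := FreeGroup.of 2 ^ 4) (by simp [rels])
  rw [map_pow] at this
  exact this
theorem h1 : s * t * u = t * u * s := by
  have := PresentedGroup.one_of_mem (rels := rels) (x := FreeGroup.of 0 * FreeGroup.of 1 * FreeGroup.of 2 *
      (FreeGroup.of 1 * FreeGroup.of 2 * FreeGroup.of 0)⁻¹) (by simp [rels])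
  simp only [map_mul, map_inv] at this
  exact mul_inv_eq_one.1 this
theorem h2 : s * t * u = u * s * t := by
  have := PresentedGroup.one_of_mem (rels := rels) (x := FreeGroup.of 0 * FreeGroup.of 1 * FreeGroup.of 2 *
      (FreeGroup.of 2 * FreeGroup.of 0 * FreeGroup.of 1)⁻¹) (by simp [rels])
  simp only [map_mul, map_inv] at this
  exact mul_inv_eq_one.1 this

theorem ss : s * s = 1 := by rw [← pow_two]; exact hs
theorem zs : Commute z s := by
  show z * s = s * z
  conv_rhs => rw [z, h1]
  simp only [z, mul_assoc]
theorem zu : Commute z u := by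
  show z * u = u * z
  conv_lhs => rw [z, h2]
  simp only [z, mul_assoc]

theorem t_eq : t = z * (s * u⁻¹) := by
  have hsi : s⁻¹ = s := inv_eq_of_mul_eq_one_left ss
  rw [← mul_assoc, zs.eq, z]
  simp only [mul_assoc, mul_inv_cancel, mul_one]
  rw [← mul_assoc, ss, one_mul]

theorem z3 : z ^ 3 = (u * s) ^ 3 := by
  have h := ht
  have hsi : s⁻¹ = s := inv_eq_of_mul_eq_one_left ss
  rw [t_eq, (zs.mul_right zu.inv_right).mul_pow] at h
  rw [eq_inv_of_mul_eq_one_left h, ← inv_pow, mul_inv_rev, inv_inv, hsi]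

/-- Abstract computation with a central element `c = (us)^3`. -/
theorem rel_a {G : Type*} [Group G] {a b c : G} (ha : a * a = 1) (hb : b ^ 4 = 1)
    (hc : c = (b * a) ^ 3) (hca : Commute c a) (hcb : Commute c b) :
    a * b * a * b = c * b ^ 3 * a ∧ a * b ^ 2 * a * b = c ^ 2 * b ^ 3 * (a * b ^ 2 * a) ∧
    a * b ^ 3 = c⁻¹ * b * (a * b * a) ∧ c ^ 8 = 1 := by
  have hai : a⁻¹ = a := inv_eq_of_mul_eq_one_left ha
  have hb3 : b ^ 3 = b⁻¹ := by
    apply eq_inv_of_mul_eq_one_left; rw [← pow_succ]; exact hb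
  have hb2 : b⁻¹ * b⁻¹ = b ^ 2 := by
    rw [← hb3, ← pow_add, show 3 + 3 = 4 + 2 from rfl, pow_add, hb, one_mul]
  have e1 : a * b * a * b = c * b⁻¹ * a := by
    rw [hcb.inv_right.eq, hc]
    simp only [pow_succ, pow_zero, one_mul, mul_assoc, ha, mul_one, inv_mul_cancel_left]
  have e2 : a * b * a = c * (b⁻¹ * a * b⁻¹) := by
    rw [← mul_assoc, ← mul_assoc, ← e1, mul_inv_cancel_right]
  have e3 : b * a * b = c * (a * b⁻¹ * a) := by
    have : b * a * b = a * (a * b * a * b) := by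
      simp only [← mul_assoc, ha, one_mul]
    rw [this, e1]
    simp only [← mul_assoc, hca.eq]
  have e4 : a * b ^ 2 * a * b = c ^ 2 * b⁻¹ * (a * b ^ 2 * a) := by
    calc a * b ^ 2 * a * b = a * b * (b * a * b) := by simp only [pow_two, mul_assoc]
      _ = (a * b * c) * (a * b⁻¹ * a) := by rw [e3]; simp only [mul_assoc]
      _ = c * (a * b * a) * b⁻¹ * a := by
        rw [← (hca.mul_right hcb).eq]; simp only [mul_assoc]
      _ = c ^ 2 * b⁻¹ * a * (b⁻¹ * b⁻¹) * a := by
        rw [e2]; simp only [pow_two, mul_assoc]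
      _ = _ := by rw [hb2]; simp only [mul_assoc]
  refine ⟨by rw [hb3, e1], by rw [hb3, e4], ?_, ?_⟩
  · rw [hb3, e2, hcb.inv_left.eq]
    simp only [mul_assoc, inv_mul_cancel_left, mul_inv_cancel_left]
  · have hS : SemiconjBy (a * b ^ 2 * a) b (c ^ 2 * b⁻¹) := e4
    have h4 := (hS.pow_right 4).eq
    rw [hb, mul_one, (hcb.inv_right.pow_left 2).mul_pow, inv_pow, hb, inv_one, mul_one,
      ← pow_mul] at h4
    exact (mul_eq_right.1 h4.symm)

theorem z3s : Commute (z ^ 3) s := zs.pow_left 3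
theorem z3u : Commute (z ^ 3) u := zu.pow_left 3

def X (k : Fin 6) : G11 := ![1, s, s * u, s * u * s, s * u ^ 2, s * u ^ 2 * s] k

def S : Set G11 := {g | ∃ (i j : ℕ) (k : Fin 6), g = (z ^ 3) ^ i * u ^ j * X k}

theorem memS {x w : G11} (i j : ℕ) (a b : ℕ) (k : Fin 6)
    (h : x * w = (z ^ 3) ^ a * u ^ b * X k) : (z ^ 3) ^ i * u ^ j * x * w ∈ S := by
  refine ⟨i + a, j + b, k, ?_⟩
  rw [mul_assoc, h, pow_add, pow_add]
  have := (z3u.pow_left a).pow_right j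
  simp only [mul_assoc]
  rw [← mul_assoc (u ^ j), ← this.eq]
  simp only [mul_assoc]

theorem S_s {g : G11} (hg : g ∈ S) : g * s ∈ S := by
  obtain ⟨i, j, k, rfl⟩ := hg
  fin_cases k
  · exact memS i j 0 0 1 (by simp [X])
  · exact memS i j 0 0 0 (by simp [X, ss])
  · exact memS i j 0 0 3 (by simp [X])
  · exact memS i j 0 0 2 (by simp [X, ss, mul_assoc])
  · exact memS i j 0 0 5 (by simp [X])
  · exact memS i j 0 0 4 (by simp [X, ss, mul_assoc])

theorem S_u {g : G11} (hg : g ∈ S) : g * u ∈ S := by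
  obtain ⟨r1, r2, r3, r4⟩ := rel_a ss hu z3 z3s z3u
  obtain ⟨i, j, k, rfl⟩ := hg
  fin_cases k
  · exact memS i j 0 1 0 (by simp [X])
  · exact memS i j 0 0 2 (by simp [X])
  · exact memS i j 0 0 4 (by simp [X, pow_two, mul_assoc])
  · exact memS i j 1 3 1 (by simpa [X] using r1)
  · refine memS i j 7 1 3 ?_
    have : (z ^ 3)⁻¹ = (z ^ 3) ^ 7 := by
      apply inv_eq_of_mul_eq_one_left; rw [← pow_succ]; exact r4
    rw [this] at r3
    rw [pow_one]
    refine Eq.trans ?_ r3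
    show s * u ^ 2 * u = _
    rw [mul_assoc, ← pow_succ]
  · exact memS i j 2 3 5 (by simpa [X] using r2)

theorem S_upow {g : G11} (hg : g ∈ S) (n : ℕ) : g * u ^ n ∈ S := by
  induction n with
  | zero => simpa using hg
  | succ n ih => rw [pow_succ, ← mul_assoc]; exact S_u ih

theorem G9_sub {g : G11} (hg : g ∈ G9) : g ∈ S := by
  unfold G9 at hg
  have hsi : s⁻¹ = s := inv_eq_of_mul_eq_one_left ss
  have hui : u⁻¹ = u ^ 3 := by
    apply inv_eq_of_mul_eq_one_left; rw [← pow_succ]; exact hu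
  induction hg using Subgroup.closure_induction_right with
  | one => exact ⟨0, 0, 0, by simp [X]⟩
  | mul_right x hx y hy ih =>
    rcases hy with rfl | rfl
    · exact S_s ih
    · exact S_u ih
  | mul_inv_cancel x hx y hy ih =>
    rcases hy with rfl | rfl
    · rw [hsi]; exact S_s ih
    · rw [hui]; exact S_upow ih 3

theorem z38 : (z ^ 3) ^ 8 = 1 := (rel_a ss hu z3 z3s z3u).2.2.2

/-- Homomorphisms out of `G11`. -/
def homOf {H : Type*} [Group H] (f : Fin 3 → H) (a : f 0 ^ 2 = 1) (b : f 1 ^ 3 = 1)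
    (c : f 2 ^ 4 = 1) (d : f 0 * f 1 * f 2 = f 1 * f 2 * f 0)
    (e : f 0 * f 1 * f 2 = f 2 * f 0 * f 1) : G11 →* H :=
  PresentedGroup.toGroup (f := f) (by
    intro r hr
    simp only [rels, Set.mem_insert_iff, Set.mem_singleton_iff] at hr
    rcases hr with rfl | rfl | rfl | rfl | rfl
    · simpa using a
    · simpa using b
    · simpa using c
    · simp only [map_mul, map_inv, FreeGroup.lift_apply_of]; exact mul_inv_eq_one.2 d
    · simp only [map_mul, map_inv, FreeGroup.lift_apply_of]; exact mul_inv_eq_one.2 e)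

def pS : Equiv.Perm (Fin 4) := ⟨![1,0,2,3], ![1,0,2,3], by decide, by decide⟩
def pU : Equiv.Perm (Fin 4) := ⟨![1,2,3,0], ![3,0,1,2], by decide, by decide⟩
def pT : Equiv.Perm (Fin 4) := pS⁻¹ * pU⁻¹

def permHom : G11 →* Equiv.Perm (Fin 4) :=
  homOf ![pS, pT, pU] (by decide) (by decide) (by decide) (by decide) (by decide)

theorem perm_s : permHom s = pS := by
  unfold permHom homOf s
  rw [PresentedGroup.toGroup.of]
  rfl
theorem perm_t : permHom t = pT := by
  unfold permHom homOf t
  rw [PresentedGroup.toGroup.of]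
  rfl
theorem perm_u : permHom u = pU := by
  unfold permHom homOf u
  rw [PresentedGroup.toGroup.of]
  rfl
theorem perm_z : permHom z = 1 := by
  rw [z, map_mul, map_mul, perm_s, perm_t, perm_u]; decide
def pX (k : Fin 6) : Equiv.Perm (Fin 4) :=
  ![1, pS, pS * pU, pS * pU * pS, pS * pU ^ 2, pS * pU ^ 2 * pS] k

theorem perm_X (k : Fin 6) : permHom (X k) = pX k := by
  fin_cases k <;> simp [X, pX, perm_s, perm_u]

theorem perm_inj : ∀ (j j' : Fin 4) (k k' : Fin 6),
    pU ^ (j : ℕ) * pX k = pU ^ (j' : ℕ) * pX k' → j = j' ∧ k = k' := by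
  decide +kernel

theorem memZ {y : G11} : y ∈ ({1, z ^ 3, z ^ 6, z ^ 9, z ^ 12, z ^ 15, z ^ 18, z ^ 21} : Set G11) ↔
    ∃ i : Fin 8, y = (z ^ 3) ^ (i : ℕ) := by
  simp [Fin.exists_fin_succ, ← pow_mul]

theorem memU {y : G11} : y ∈ ({1, u, u ^ 2, u ^ 3} : Set G11) ↔ ∃ i : Fin 4, y = u ^ (i : ℕ) := by
  simp [Fin.exists_fin_succ]

theorem memX {y : G11} : y ∈ ({1, s, s * u, s * u * s, s * u ^ 2, s * u ^ 2 * s} : Set G11) ↔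
    ∃ k : Fin 6, y = X k := by
  simp [Fin.exists_fin_succ, X]

theorem s_mem : s ∈ G9 := Subgroup.subset_closure (by simp)
theorem u_mem : u ∈ G9 := Subgroup.subset_closure (by simp)

theorem X_mem (k : Fin 6) : X k ∈ G9 := by
  have := s_mem
  have := u_mem
  fin_cases k
  · exact one_mem _
  · exact s_mem
  · exact mul_mem s_mem u_mem
  · exact mul_mem (mul_mem s_mem u_mem) s_mem
  · exact mul_mem s_mem (pow_mem u_mem 2)
  · exact mul_mem (mul_mem s_mem (pow_mem u_mem 2)) s_mem

theorem statement10 :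
    Set.BijOn (fun p : G11 × G11 × G11 => p.1 * p.2.1 * p.2.2)
      (({1, z ^ 3, z ^ 6, z ^ 9, z ^ 12, z ^ 15, z ^ 18, z ^ 21} : Set G11) ×ˢ (({1, u, u ^ 2, u ^ 3} : Set G11) ×ˢ ({1, s, s * u, s * u * s, s * u ^ 2, s * u ^ 2 * s} : Set G11)))
      (G9 : Set G11) := by
  refine ⟨?_, ?_, ?_⟩
  · rintro ⟨y, v, x⟩ ⟨hy, hv, hx⟩
    obtain ⟨i, rfl⟩ := memZ.1 hy
    obtain ⟨j, rfl⟩ := memU.1 hv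
    obtain ⟨k, rfl⟩ := memX.1 hx
    refine mul_mem (mul_mem (pow_mem ?_ _) (pow_mem u_mem _)) (X_mem k)
    rw [z3]
    exact pow_mem (mul_mem u_mem s_mem) 3
  · rintro ⟨y, v, x⟩ ⟨hy, hv, hx⟩ ⟨y', v', x'⟩ ⟨hy', hv', hx'⟩ h
    obtain ⟨i, rfl⟩ := memZ.1 hy
    obtain ⟨j, rfl⟩ := memU.1 hv
    obtain ⟨k, rfl⟩ := memX.1 hx
    obtain ⟨i', rfl⟩ := memZ.1 hy'
    obtain ⟨j', rfl⟩ := memU.1 hv'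
    obtain ⟨k', rfl⟩ := memX.1 hx'
    dsimp only at h
    have hp := congrArg permHom h
    simp only [map_mul, map_pow, perm_z, perm_u, perm_X, one_pow, one_mul] at hp
    obtain ⟨rfl, rfl⟩ := perm_inj _ _ _ _ hp
    rw [mul_left_inj, mul_left_inj] at h
    rw [h]
  · intro g hg
    obtain ⟨i, j, k, rfl⟩ := G9_sub hg
    refine ⟨((z ^ 3) ^ i, u ^ j, X k), ⟨memZ.2 ⟨⟨i % 8, Nat.mod_lt _ (by norm_num)⟩, ?_⟩,
      memU.2 ⟨⟨j % 4, Nat.mod_lt _ (by norm_num)⟩, ?_⟩, memX.2 ⟨k, rfl⟩⟩, rfl⟩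
    · exact pow_eq_pow_mod i z38
    · exact pow_eq_pow_mod j hu

end Octa
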